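/- arXiv:2007.13550 — 4 statements merged into one kernel-verified Lean document; each statement's English description precedes it below -/
import Mathlib

section
/- There exist four families 𝒞₁, 𝒞₂, ℬ₁, ℬ₂ of subfields K of ℝ, each of cardinality 2^𝔠, such that ℝ is algebraic over every field K in 𝒞₁ ∪ 𝒞₂ ∪ ℬ₁ ∪ ℬ₂, every field in 𝒞₁ ∪ 𝒞₂ is a Cantor field, every field in ℬ₁ ∪ ℬ₂ is a Bernstein field, all fields in 𝒞₁ ∪ ℬ₁ are pairwise isomorphic as fields, and the fields in 𝒞₂ ∪ ℬ₂ are pairwise incomparable, i.e. for distinct K, L ∈ 𝒞₂ ∪ ℬ₂ there is no ring homomorphism from K into L. -/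
noncomputable section

open Set Cardinal

/-- A Cantor set: a nonempty compact subset of ℝ that is totally disconnected
and dense in itself (no isolated points). -/
def IsCantorSet (C : Set ℝ) : Prop :=
  C.Nonempty ∧ IsCompact C ∧ IsTotallyDisconnected C ∧ Preperfect C

/-- A Bernstein set: neither it nor its complement contains a Cantor set. -/
def IsBernsteinSet (B : Set ℝ) : Prop :=
  (¬ ∃ C ⊆ B, IsCantorSet C) ∧ (¬ ∃ C ⊆ Bᶜ, IsCantorSet C)

/-- A Cantor field: a proper subfield of ℝ containing a Cantor set. -/
def IsCantorField (K : Subfield ℝ) : Prop :=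
  K ≠ ⊤ ∧ ∃ C ⊆ (K : Set ℝ), IsCantorSet C

/-- A Bernstein field: a subfield of ℝ which is a Bernstein set. -/
def IsBernsteinField (K : Subfield ℝ) : Prop :=
  IsBernsteinSet (K : Set ℝ)

theorem exists_transcendental_mem {S D : Set ℝ} (hS : #S = 𝔠) (hD : #D < 𝔠) :
    ∃ z ∈ S, Transcendental (Algebra.adjoin ℚ D) z := by
  by_contra! h
  have hsub : S ⊆ {z : ℝ | IsAlgebraic (Algebra.adjoin ℚ D) z} := fun z hz => by
    simpa [Transcendental] using h z hz
  have h1 : #(Algebra.adjoin ℚ D) < 𝔠 := by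
    refine (Algebra.cardinalMk_adjoin_le (R := ℚ) D).trans_lt ?_
    simp [hD, aleph0_lt_continuum]
  have h2 := (mk_le_mk_of_subset hsub).trans
    (Algebraic.cardinalMk_le_max (Algebra.adjoin ℚ D) ℝ)
  rw [hS] at h2
  exact absurd h2 (not_le.2 (max_lt h1 aleph0_lt_continuum))

/-- At most continuum many sets of size continuum admit an algebraically independent
system of representatives. -/
theorem exists_algebraicIndependent_mem {J : Type} (S : J → Set ℝ) (hJ : #J ≤ 𝔠)
    (hS : ∀ j, #(S j) = 𝔠) : ∃ x : J → ℝ, (∀ j, x j ∈ S j) ∧ AlgebraicIndependent ℚ x := by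
  classical
  obtain ⟨r, wo, hr⟩ := exists_ord_eq J
  choose! pick hpick htrans using
    fun (j : J) (D : Set ℝ) (hD : #D < 𝔠) => exists_transcendental_mem (hS j) hD
  let x : J → ℝ := wo.wf.fix fun j ih => pick j (range fun i : {i // r i j} => ih i i.2)
  have hx : ∀ j, x j = pick j (range fun i : {i // r i j} => x i) := fun j => wo.wf.fix_eq _ _
  have hcard : ∀ j, #(range fun i : {i // r i j} => x i) < 𝔠 := fun j =>
    mk_range_le.trans_lt ((card_typein_lt j hr).trans_le hJ)
  refine ⟨x, fun j => hx j ▸ hpick j _ (hcard j), ?_⟩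
  let _ : LinearOrder J := linearOrderOfSTO r
  refine algebraicIndependent_of_finite_type fun t ht => ?_
  obtain ⟨t, rfl⟩ := ht.exists_finset_coe
  clear ht
  induction t using Finset.induction_on_max with
  | empty =>
    have : IsEmpty ((∅ : Finset J) : Set J) := by simp
    exact algebraicIndependent_empty_type
  | insert a s hs ih =>
    rw [Finset.coe_insert]
    refine AlgebraicIndepOn.insert ih ?_
    have := htrans a _ (hcard a)
    rw [← hx] at this
    refine this.of_tower_top_of_subalgebra_le (Algebra.adjoin_mono ?_)
    rintro _ ⟨i, hi, rfl⟩
    exact ⟨⟨i, hs i hi⟩, rfl⟩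

/-- The tuples in Cantor space whose entries differ pairwise before position `n`. -/
def separatedTuples (k n : ℕ) : Set (Fin k → ℕ → Bool) :=
  {s | ∀ i j, i ≠ j → ∃ l < n, s i l ≠ s j l}

theorem isClosed_separatedTuples (k n : ℕ) : IsClosed (separatedTuples k n) := by
  have : separatedTuples k n =
      ⋂ (i) (j) (_ : i ≠ j), ⋃ l ∈ Finset.range n, {s | s i l ≠ s j l} := by
    ext s; simp [separatedTuples]
  rw [this]
  refine isClosed_iInter fun i => isClosed_iInter fun j => isClosed_iInter fun _ =>
    isClosed_biUnion_finset fun l _ => ?_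
  have hc : Continuous fun s : Fin k → ℕ → Bool => (s i l, s j l) := by fun_prop
  exact (isClosed_discrete {q : Bool × Bool | q.1 ≠ q.2}).preimage hc

theorem exists_mem_separatedTuples {k : ℕ} {s : Fin k → ℕ → Bool} (hs : Function.Injective s) :
    ∃ n, s ∈ separatedTuples k n := by
  have h : ∀ i j, ∃ l, i ≠ j → s i l ≠ s j l := fun i j => by
    by_cases hij : i = j
    · exact ⟨0, fun h => absurd hij h⟩
    · obtain ⟨l, hl⟩ := Function.ne_iff.1 (hs.ne hij)
      exact ⟨l, fun _ => hl⟩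
  choose l hl using h
  refine ⟨(Finset.univ.sup fun q : Fin k × Fin k => l q.1 q.2) + 1, fun i j hij =>
    ⟨l i j, Nat.lt_succ_of_le ?_, hl i j hij⟩⟩
  exact Finset.le_sup (f := fun q : Fin k × Fin k => l q.1 q.2) (Finset.mem_univ (i, j))

/-- The maps on Cantor space whose values at `n`-separated tuples never satisfy `p`. -/
def nonvanishingMaps {k : ℕ} (p : MvPolynomial (Fin k) ℚ) (n : ℕ) : Set C(ℕ → Bool, ℝ) :=
  {f | ∀ s ∈ separatedTuples k n, MvPolynomial.aeval (fun i => f (s i)) p ≠ 0}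

theorem isOpen_nonvanishingMaps {k : ℕ} (p : MvPolynomial (Fin k) ℚ) (n : ℕ) :
    IsOpen (nonvanishingMaps p n) := by
  have hcont : Continuous fun q : C(ℕ → Bool, ℝ) × (Fin k → ℕ → Bool) =>
      MvPolynomial.aeval (fun i => q.1 (q.2 i)) p := by
    simp only [MvPolynomial.aeval_def, MvPolynomial.eval₂_eq]
    fun_prop
  rw [← isClosed_compl_iff]
  have hcl : IsClosed {q : C(ℕ → Bool, ℝ) × (Fin k → ℕ → Bool) |
      q.2 ∈ separatedTuples k n ∧ MvPolynomial.aeval (fun i => q.1 (q.2 i)) p = 0} :=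
    ((isClosed_separatedTuples k n).preimage continuous_snd).inter
      (isClosed_singleton.preimage hcont)
  convert isClosedMap_fst_of_compactSpace _ hcl using 1
  ext f
  simp [nonvanishingMaps]

/-- The first `m` terms of a sequence. -/
def initialSegment (m : ℕ) (s : ℕ → Bool) : Fin m → Bool := fun i => s i

/-- A sequence with prescribed first `m` terms. -/
def extendSegment (m : ℕ) (q : Fin m → Bool) : ℕ → Bool :=
  fun i => if h : i < m then q ⟨i, h⟩ else false

theorem exists_dist_extendSegment_lt (f : C(ℕ → Bool, ℝ)) (n : ℕ) {ε : ℝ} (hε : 0 < ε) :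
    ∃ m ≥ n, ∀ s, dist (f (extendSegment m (initialSegment m s))) (f s) < ε := by
  have hloc : ∀ s : ℕ → Bool, ∃ m, ∀ t ∈ PiNat.cylinder s m, dist (f t) (f s) < ε / 2 := fun s => by
    have ho : IsOpen (f ⁻¹' Metric.ball (f s) (ε / 2)) := Metric.isOpen_ball.preimage f.continuous
    obtain ⟨v, ⟨z, m, rfl⟩, hsv, hv⟩ :=
      (PiNat.isTopologicalBasis_cylinders (fun _ => Bool)).exists_subset_of_mem_open
        (show s ∈ f ⁻¹' Metric.ball (f s) (ε / 2) by simpa using half_pos hε) ho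
    rw [← PiNat.mem_cylinder_iff_eq.1 hsv] at hv
    exact ⟨m, hv⟩
  choose m hm using hloc
  obtain ⟨t, ht⟩ := CompactSpace.elim_nhds_subcover (fun s => PiNat.cylinder s (m s))
    fun s => (PiNat.isOpen_cylinder (fun _ => Bool) s (m s)).mem_nhds (PiNat.self_mem_cylinder s _)
  refine ⟨max n (t.sup m), le_max_left _ _, fun s => ?_⟩
  obtain ⟨z, hz, hs⟩ : ∃ z ∈ t, s ∈ PiNat.cylinder z (m z) := by
    simpa using ht.ge (mem_univ s)
  have hs' : extendSegment (max n (t.sup m)) (initialSegment (max n (t.sup m)) s) ∈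
      PiNat.cylinder z (m z) := fun i hi => by
    have : i < max n (t.sup m) := hi.trans_le ((Finset.le_sup hz).trans (le_max_right _ _))
    simpa [extendSegment, initialSegment, this] using hs i hi
  have h1 := hm z _ hs
  have h2 := hm z _ hs'
  linarith [dist_triangle_right (f (extendSegment _ (initialSegment (max n (t.sup m)) s)))
    (f s) (f z)]

theorem dense_nonvanishingMaps {k : ℕ} {p : MvPolynomial (Fin k) ℚ} (hp : p ≠ 0) (n : ℕ) :
    Dense (nonvanishingMaps p n) := by
  refine Metric.dense_iff.2 fun f ε hε => ?_
  obtain ⟨m, hm, hf⟩ := exists_dist_extendSegment_lt f n (half_pos (half_pos hε))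
  obtain ⟨x, hx, hind⟩ := exists_algebraicIndependent_mem
    (fun q : Fin m → Bool =>
      Ioo (f (extendSegment m q) - ε / 4) (f (extendSegment m q) + ε / 4))
    ((lt_aleph0_of_finite _).le.trans aleph0_le_continuum)
    (fun q => mk_Ioo_real (by linarith))
  have hcont : Continuous (initialSegment m) := by unfold initialSegment; fun_prop
  refine ⟨⟨fun s => x (initialSegment m s), continuous_of_discreteTopology.comp hcont⟩, ?_, ?_⟩
  · rw [Metric.mem_ball, ContinuousMap.dist_lt_iff hε]
    intro s
    have h1 := hx (initialSegment m s)
    have h2 := abs_lt.1 (hf s)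
    simp only [ContinuousMap.coe_mk, Real.dist_eq, abs_lt]
    constructor <;> linarith [h1.1, h1.2, h2.1, h2.2]
  · intro s hs h0
    have hinj : Function.Injective fun i => initialSegment m (s i) := fun i j hij => by
      by_contra hne
      obtain ⟨l, hl, hsl⟩ := hs i j hne
      exact hsl (congrFun hij ⟨l, hl.trans_le hm⟩)
    exact hp ((hind.comp _ hinj).eq_zero_of_aeval_eq_zero p h0)

theorem exists_algebraicIndependent_continuousMap :
    ∃ f : C(ℕ → Bool, ℝ), AlgebraicIndependent ℚ f := by
  have hcount (k : ℕ) : Countable (MvPolynomial (Fin k) ℚ) :=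
    mk_le_aleph0_iff.1 (MvPolynomial.cardinalMk_le_max.trans (by simp))
  have hd := dense_iInter_of_isOpen
    (f := fun q : (Σ k, {p : MvPolynomial (Fin k) ℚ // p ≠ 0}) × ℕ => nonvanishingMaps q.1.2.1 q.2)
    (fun q => isOpen_nonvanishingMaps _ _) (fun q => dense_nonvanishingMaps q.1.2.2 _)
  obtain ⟨f, hf⟩ := hd.nonempty
  refine ⟨f, algebraicIndependent_iff.2 fun p hp => ?_⟩
  obtain ⟨k, s, hs, q, rfl⟩ := p.exists_fin_rename
  by_contra hne
  have hq : q ≠ 0 := fun h => hne (by simp [h])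
  obtain ⟨n, hn⟩ := exists_mem_separatedTuples hs
  rw [MvPolynomial.aeval_rename] at hp
  exact mem_iInter.1 hf (⟨k, q, hq⟩, n) s hn hp

theorem isCantorSet_of_perfect {D : Set ℝ} (hD : Perfect D) (hne : D.Nonempty)
    (hcomp : IsCompact D) (hq : ∀ x ∈ D, Transcendental ℚ x) : IsCantorSet D := by
  refine ⟨hne, hcomp, fun t ht hpre x hx y hy => ?_, hD.2⟩
  by_contra hxy
  wlog hlt : x < y generalizing x y
  · exact this y hy x hx (Ne.symm hxy) (lt_of_le_of_ne (not_lt.1 hlt) (Ne.symm hxy))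
  obtain ⟨q, h1, h2⟩ := exists_rat_btwn hlt
  exact hq _ (ht (hpre.ordConnected.out hx hy ⟨h1.le, h2.le⟩)) (isAlgebraic_algebraMap q)

/-- The real cube root of `2`. -/
def cbrtTwo : ℝ := 2 ^ (1 / 3 : ℝ)

theorem cbrtTwo_pow : cbrtTwo ^ 3 = 2 := by
  rw [cbrtTwo, ← Real.rpow_natCast, ← Real.rpow_mul (by norm_num)]
  norm_num

theorem cbrtTwo_ne_zero : cbrtTwo ≠ 0 := fun h => by
  have := cbrtTwo_pow
  simp [h] at this

theorem rat_pow_three_ne_two (q : ℚ) : q ^ 3 ≠ 2 := fun h => by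
  refine (irrational_nrt_of_notint_nrt (x := (q : ℝ)) 3 2 (by exact_mod_cast h) ?_ (by norm_num))
    ⟨q, rfl⟩
  rintro ⟨y, hy⟩
  have h2 : y ^ 3 = 2 := by
    have : (q : ℝ) ^ 3 = 2 := by exact_mod_cast h
    rw [hy] at this
    exact_mod_cast this
  rcases le_or_gt y 1 with h3 | h3
  · rcases le_or_gt y 0 with h4 | h4
    · nlinarith [sq_nonneg y]
    · obtain rfl : y = 1 := by omega
      omega
  · nlinarith [sq_nonneg y]

theorem isAlgebraic_cbrtTwo : IsAlgebraic ℚ cbrtTwo :=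
  IsAlgebraic.of_pow (n := 3) (by norm_num) (by
    rw [cbrtTwo_pow]; exact_mod_cast isAlgebraic_algebraMap (2 : ℚ))

/-- The field generated by an algebraically independent family is a rational function field. -/
def AlgebraicIndependent.fractionRingEquiv {F E ι : Type*} [Field F] [Field E] [Algebra F E]
    {x : ι → E} (hx : AlgebraicIndependent F x) :
    FractionRing (MvPolynomial ι F) ≃+* IntermediateField.adjoin F (range x) :=
  hx.aevalEquivField.toRingEquiv

theorem cbrtTwo_notMem_adjoin {ι : Type*} {y : ι → ℝ} (hy : AlgebraicIndependent ℚ y) :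
    cbrtTwo ∉ IntermediateField.adjoin ℚ (range y) := fun h => by
  obtain ⟨z, hz⟩ := hy.fractionRingEquiv.surjective ⟨cbrtTwo, h⟩
  have hz3 : z ^ 3 = 2 := by
    apply hy.fractionRingEquiv.injective
    rw [map_pow, hz, map_ofNat]
    apply Subtype.ext
    exact cbrtTwo_pow
  obtain ⟨p, q, hq, rfl⟩ := IsFractionRing.div_surjective (A := MvPolynomial ι ℚ) z
  have hq0 : q ≠ 0 := nonZeroDivisors.ne_zero hq
  have hq1 : algebraMap (MvPolynomial ι ℚ) (FractionRing (MvPolynomial ι ℚ)) q ≠ 0 := by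
    simpa using hq0
  have hpq : p ^ 3 = 2 * q ^ 3 := by
    apply IsFractionRing.injective (MvPolynomial ι ℚ) (FractionRing (MvPolynomial ι ℚ))
    rw [div_pow, div_eq_iff (pow_ne_zero _ hq1)] at hz3
    simpa only [map_pow, map_mul, map_ofNat] using hz3
  obtain ⟨a, ha⟩ : ∃ a, MvPolynomial.eval a q ≠ 0 := by
    by_contra! hall
    exact hq0 (MvPolynomial.funext fun a => by simpa using hall a)
  have hev := congrArg (MvPolynomial.eval a) hpq
  simp only [map_pow, map_mul, map_ofNat] at hev
  refine rat_pow_three_ne_two (MvPolynomial.eval a p / MvPolynomial.eval a q) ?_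
  rw [div_pow, hev, mul_div_assoc, div_self (pow_ne_zero _ ha), mul_one]

/-- Multiplying some members of a family by algebraic units preserves transcendence bases. -/
theorem IsTranscendenceBasis.mul_of_isAlgebraic {F E ι : Type*} [Field F] [Field E] [Algebra F E]
    {x : ι → E} (hx : IsTranscendenceBasis F x) {u : ι → E} (hu : ∀ i, IsAlgebraic F (u i))
    (hu0 : ∀ i, u i ≠ 0) : IsTranscendenceBasis F fun i => u i * x i := by
  let K := algebraicClosure F E
  rw [Algebra.IsAlgebraic.isTranscendenceBasis_iff F K] at hx ⊢
  let v : ι → K := fun i => ⟨u i, mem_algebraicClosure_iff.2 (hu i)⟩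
  have hv : ∀ i, v i ≠ 0 := fun i h => hu0 i (congrArg Subtype.val h)
  have hind : AlgebraicIndependent K fun i => u i * x i := by
    have := hx.1.polynomial_aeval_of_transcendental
      (f := fun i => Polynomial.C (v i) * Polynomial.X) fun i =>
        Polynomial.transcendental _ (by simp [Polynomial.natDegree_C_mul_X _ (hv i)])
          (by simpa using hv i)
    convert this using 2 with i
    simp [v, Algebra.algebraMap_eq_smul_one, IntermediateField.smul_def]
  rw [hind.isTranscendenceBasis_iff_isAlgebraic]
  have halg := hx.isAlgebraic
  have heq : Algebra.adjoin K (range fun i => u i * x i) = Algebra.adjoin K (range x) := by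
    apply le_antisymm <;> refine Algebra.adjoin_le ?_ <;> rintro _ ⟨i, rfl⟩
    · exact (Algebra.adjoin K (range x)).smul_mem (Algebra.subset_adjoin ⟨i, rfl⟩) (v i)
    · have := (Algebra.adjoin K (range fun i => u i * x i)).smul_mem
        (Algebra.subset_adjoin ⟨i, rfl⟩) (v i)⁻¹
      have h2 : (v i)⁻¹ • (u i * x i) = x i := by
        change (u i)⁻¹ * (u i * x i) = x i
        rw [inv_mul_cancel_left₀ (hu0 i)]
      exact h2 ▸ this
  rwa [heq]

theorem exists_maximal_notMem (K : Subfield ℝ) {c : ℝ} (hc : c ∉ K) :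
    ∃ E, K ≤ E ∧ Maximal (fun L : Subfield ℝ => c ∉ L) E := by
  refine zorn_le_nonempty₀ {L : Subfield ℝ | c ∉ L} (fun S hS hch y hy => ?_) K hc
  refine ⟨sSup S, ?_, fun z hz => le_sSup hz⟩
  rw [mem_ofPred_eq, Subfield.mem_sSup_of_directedOn ⟨y, hy⟩ hch.directedOn]
  rintro ⟨s, hs, hcs⟩
  exact hS hs hcs

theorem sqrt_mem_of_maximal_cbrtTwo_notMem {E : Subfield ℝ}
    (hE : Maximal (fun L : Subfield ℝ => cbrtTwo ∉ L) E) {x : ℝ} (hx : x ∈ E) (h0 : 0 ≤ x) :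
    √x ∈ E := by
  by_contra hr
  have hsq : √x * √x = x := Real.mul_self_sqrt h0
  have hint : IsIntegral E √x := by
    refine IsIntegral.of_pow (n := 2) (by norm_num) ?_
    rw [Real.sq_sqrt h0]
    exact isIntegral_algebraMap (x := (⟨x, hx⟩ : E))
  let L := IntermediateField.adjoin E {√x}
  have hEL : E ≤ L.toSubfield := fun y hy => L.algebraMap_mem ⟨y, hy⟩
  have hrL : √x ∈ L := IntermediateField.mem_adjoin_simple_self E _
  have hcL : cbrtTwo ∈ L := by
    by_contra hc
    exact hr (hE.2 (y := L.toSubfield) hc hEL hrL)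
  have hform : ∀ z ∈ Algebra.adjoin E {√x}, ∃ a ∈ E, ∃ b ∈ E, z = a + b * √x := by
    intro z hz
    induction hz using Algebra.adjoin_induction with
    | mem z hz => exact ⟨0, E.zero_mem, 1, E.one_mem, by simpa using hz⟩
    | algebraMap r => exact ⟨r, r.2, 0, E.zero_mem, by simp [Subfield.algebraMap_ofSubfield]⟩
    | add z w _ _ hz hw =>
      obtain ⟨a, ha, b, hb, rfl⟩ := hz
      obtain ⟨a', ha', b', hb', rfl⟩ := hw
      exact ⟨a + a', E.add_mem ha ha', b + b', E.add_mem hb hb', by ring⟩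
    | mul z w _ _ hz hw =>
      obtain ⟨a, ha, b, hb, rfl⟩ := hz
      obtain ⟨a', ha', b', hb', rfl⟩ := hw
      refine ⟨a * a' + b * b' * x, E.add_mem (E.mul_mem ha ha') (E.mul_mem (E.mul_mem hb hb') hx),
        a * b' + a' * b, E.add_mem (E.mul_mem ha hb') (E.mul_mem ha' hb), ?_⟩
      linear_combination b * b' * hsq
  obtain ⟨a, ha, b, hb, hab⟩ := hform cbrtTwo (by
    rw [← IntermediateField.adjoin_simple_toSubalgebra_of_isAlgebraic hint.isAlgebraic]
    exact hcL)
  have hcube := cbrtTwo_pow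
  have hexp : (a ^ 3 + 3 * a * b ^ 2 * x) + (3 * a ^ 2 * b + b ^ 3 * x) * √x = 2 := by
    rw [hab] at hcube
    linear_combination hcube - (3 * a * b ^ 2 + b ^ 3 * √x) * hsq
  have hn : ∀ n : ℕ, (n : ℝ) ∈ E := fun n => natCast_mem E n
  have hzero : 3 * a ^ 2 * b + b ^ 3 * x = 0 := by
    by_contra hne
    apply hr
    have : √x = (2 - (a ^ 3 + 3 * a * b ^ 2 * x)) / (3 * a ^ 2 * b + b ^ 3 * x) := by
      rw [eq_div_iff hne]; linear_combination hexp
    rw [this]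
    have h2 : (2 : ℝ) ∈ E := by exact_mod_cast hn 2
    have h3 : (3 : ℝ) ∈ E := by exact_mod_cast hn 3
    refine E.div_mem (E.sub_mem h2 (E.add_mem (E.pow_mem ha 3) ?_)) (E.add_mem ?_ ?_)
    · exact E.mul_mem (E.mul_mem (E.mul_mem h3 ha) (E.pow_mem hb 2)) hx
    · exact E.mul_mem (E.mul_mem h3 (E.pow_mem ha 2)) hb
    · exact E.mul_mem (E.pow_mem hb 3) hx
  have hxpos : 0 < x := lt_of_le_of_ne h0 fun h => hr (by rw [← h, Real.sqrt_zero]; exact E.zero_mem)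
  have hb0 : b = 0 := by
    by_contra hb0
    have : b * (3 * a ^ 2 + b ^ 2 * x) = 0 := by linear_combination hzero
    have h4 := (mul_eq_zero.1 this).resolve_left hb0
    have : 0 < b ^ 2 * x := by positivity
    nlinarith [sq_nonneg a]
  exact hE.1 (by rw [hab, hb0]; simpa using ha)

theorem le_of_ringHom_of_sqrt_mem {K L : Subfield ℝ} (hK : ∀ x ∈ K, 0 ≤ x → √x ∈ K)
    (φ : K →+* L) : K ≤ L := by
  let ψ : K →+* ℝ := L.subtype.comp φ
  have hmono : Monotone ψ := by
    refine (monotone_iff_map_nonneg ψ.toAddMonoidHom).2 fun a ha => ?_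
    have h0 : (0 : ℝ) ≤ a := ha
    have : a = (⟨√a, hK a a.2 h0⟩ : K) * ⟨√a, hK a a.2 h0⟩ :=
      Subtype.ext (Real.mul_self_sqrt h0).symm
    change 0 ≤ ψ a
    rw [this, map_mul]
    exact mul_self_nonneg _
  let ψ' : K →+*o ℝ := ⟨ψ, hmono⟩
  let i : K →+*o ℝ := ⟨K.subtype, fun _ _ h => h⟩
  intro x hx
  have := DFunLike.congr_fun (Subsingleton.elim i ψ') ⟨x, hx⟩
  have h : x = (φ ⟨x, hx⟩ : ℝ) := this
  exact h ▸ (φ ⟨x, hx⟩).2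

theorem Algebra.IsAlgebraic.of_subfield_le {K L : Subfield ℝ} (h : K ≤ L)
    [Algebra.IsAlgebraic K ℝ] : Algebra.IsAlgebraic L ℝ := by
  let _ : Algebra K L := (Subfield.inclusion h).toAlgebra
  have : IsScalarTower K L ℝ := IsScalarTower.of_algebraMap_eq fun _ => rfl
  exact Algebra.IsAlgebraic.tower_top (K := K) L

theorem eq_of_subfield_le {T S : Set ℝ} (hST : S ⊆ T) (h0 : ∀ t ∈ T, t ≠ 0)
    {K : Set S → Subfield ℝ} (hc : ∀ A, cbrtTwo ∉ K A)
    (hmem : ∀ A, ∀ t : S, t ∈ A → (t : ℝ) ∈ K A)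
    (hnotMem : ∀ A, ∀ t : S, t ∉ A → cbrtTwo * (t : ℝ) ∈ K A)
    {A B : Set S} (hAB : K A ≤ K B) : A = B := by
  have key : ∀ t : S, (t : ℝ) ∈ K B → cbrtTwo * (t : ℝ) ∉ K B := fun t h1 h2 => hc B <| by
    simpa [h0 t (hST t.2)] using (K B).div_mem h2 h1
  ext t
  constructor <;> intro ht <;> by_contra ht'
  · exact key t (hAB (hmem A t ht)) (hnotMem B t ht')
  · exact key t (hmem B t ht) (hAB (hnotMem A t ht'))

/-- A transcendence basis `T` of `ℝ` with `T \ T₀` of size continuum yields `2 ^ 𝔠` pairwise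
incomparable purely transcendental fields containing `T₀`, and `2 ^ 𝔠` pairwise incomparable
Euclidean fields containing `T₀`. -/
theorem exists_subfield_families {T₀ T : Set ℝ} (hT : IsTranscendenceBasis ℚ ((↑) : T → ℝ))
    (hsub : T₀ ⊆ T) (hcard : #(T \ T₀ : Set ℝ) = 𝔠) :
    ∃ F E : Set (T \ T₀ : Set ℝ) → Subfield ℝ,
      (∀ A, T₀ ⊆ F A ∧ cbrtTwo ∉ F A ∧ Algebra.IsAlgebraic (F A) ℝ ∧
        Nonempty (F A ≃+* FractionRing (MvPolynomial ℝ ℚ))) ∧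
      (∀ A, T₀ ⊆ E A ∧ cbrtTwo ∉ E A ∧ Algebra.IsAlgebraic (E A) ℝ ∧
        ∀ x ∈ E A, 0 ≤ x → √x ∈ E A) ∧
      (∀ A B, F A ≤ F B → A = B) ∧ (∀ A B, E A ≤ E B → A = B) := by
  classical
  let u : Set (T \ T₀ : Set ℝ) → T → ℝ := fun A t =>
    if (t : ℝ) ∈ T₀ ∪ (↑) '' A then 1 else cbrtTwo
  have hy : ∀ A, IsTranscendenceBasis ℚ fun t : T => u A t * t := fun A =>
    hT.mul_of_isAlgebraic
      (fun t => by
        by_cases h : (t : ℝ) ∈ T₀ ∪ (↑) '' A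
        · simpa only [u, if_pos h] using isAlgebraic_one
        · simpa only [u, if_neg h] using isAlgebraic_cbrtTwo)
      (fun t => by
        by_cases h : (t : ℝ) ∈ T₀ ∪ (↑) '' A
        · simp only [u, if_pos h]; exact one_ne_zero
        · simp only [u, if_neg h]; exact cbrtTwo_ne_zero)
  let F : Set (T \ T₀ : Set ℝ) → Subfield ℝ := fun A =>
    (IntermediateField.adjoin ℚ (range fun t : T => u A t * t)).toSubfield
  have hgen : ∀ A, ∀ t : T, u A t * t ∈ F A := fun A t =>
    IntermediateField.subset_adjoin _ _ ⟨t, rfl⟩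
  have hF0 : ∀ A, T₀ ⊆ F A := fun A t ht => by
    have := hgen A ⟨t, hsub ht⟩
    simpa [u, ht] using this
  have hFmem : ∀ A, ∀ t : (T \ T₀ : Set ℝ), t ∈ A → (t : ℝ) ∈ F A := fun A t ht => by
    have := hgen A ⟨t, t.2.1⟩
    have h : (t : ℝ) ∈ T₀ ∪ (↑) '' A := Or.inr ⟨t, ht, rfl⟩
    simpa only [u, if_pos h, one_mul] using this
  have hFnot : ∀ A, ∀ t : (T \ T₀ : Set ℝ), t ∉ A → cbrtTwo * (t : ℝ) ∈ F A := fun A t ht => by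
    have := hgen A ⟨t, t.2.1⟩
    have h : (t : ℝ) ∉ T₀ ∪ (↑) '' A := by
      rintro (h | ⟨s, hs, hst⟩)
      · exact t.2.2 h
      · exact ht (Subtype.ext hst ▸ hs)
    simpa only [u, if_neg h] using this
  have hFc : ∀ A, cbrtTwo ∉ F A := fun A => cbrtTwo_notMem_adjoin (hy A).1
  have hFalg : ∀ A, Algebra.IsAlgebraic (F A) ℝ := fun A => (hy A).isAlgebraic_field
  choose E hE using fun A => exists_maximal_notMem (F A) (hFc A)
  have hT0 : ∀ t ∈ T, t ≠ 0 := fun t ht => hT.1.ne_zero ⟨t, ht⟩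
  have hTcard : #T = #ℝ := by
    refine le_antisymm (mk_set_le T) ?_
    rw [mk_real, ← hcard]
    exact mk_le_mk_of_subset sdiff_subset
  obtain ⟨e⟩ := Cardinal.eq.1 hTcard
  have hiso : ∀ A, Nonempty (F A ≃+* FractionRing (MvPolynomial ℝ ℚ)) := fun A => by
    have hind : AlgebraicIndependent ℚ ((fun t : T => u A t * t) ∘ e.symm) :=
      (hy A).1.comp _ e.symm.injective
    have h := hind.fractionRingEquiv.symm
    rw [e.symm.surjective.range_comp] at h
    exact ⟨h⟩
  refine ⟨F, E, fun A => ⟨hF0 A, hFc A, hFalg A, hiso A⟩, fun A => ⟨(hF0 A).trans (hE A).1,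
    (hE A).2.1, ?_, fun x hx h0 => sqrt_mem_of_maximal_cbrtTwo_notMem (hE A).2 hx h0⟩,
    fun A B => ?_, fun A B => ?_⟩
  · have := hFalg A
    exact .of_subfield_le (hE A).1
  · exact eq_of_subfield_le sdiff_subset hT0 hFc hFmem hFnot
  · exact eq_of_subfield_le sdiff_subset hT0 (fun A => (hE A).2.1)
      (fun A t ht => (hE A).1 (hFmem A t ht)) (fun A t ht => (hE A).1 (hFnot A t ht))

theorem Perfect.mk_real_eq {D : Set ℝ} (hD : Perfect D) (hne : D.Nonempty) : #D = 𝔠 := by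
  obtain ⟨f, hf, -, hinj⟩ := hD.exists_nat_bool_injection hne
  refine le_antisymm ((mk_set_le D).trans_eq mk_real) ?_
  have := (mk_range_eq f hinj).symm.trans_le (mk_le_mk_of_subset hf)
  simpa using this

theorem IsCantorSet.mk_eq {C : Set ℝ} (hC : IsCantorSet C) : #C = 𝔠 :=
  Perfect.mk_real_eq ⟨hC.2.1.isClosed, hC.2.2.2⟩ hC.1

theorem IsCantorSet.image_add_left {C : Set ℝ} (hC : IsCantorSet C) (c : ℝ) :
    IsCantorSet ((fun x => c + x) '' C) := by
  have hemb : Topology.IsEmbedding fun x : ℝ => c + x := (Homeomorph.addLeft c).isEmbedding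
  refine ⟨hC.1.image _, hC.2.1.image hemb.continuous,
    hemb.isTotallyDisconnected_image.2 hC.2.2.1, ?_⟩
  rintro _ ⟨x, hx, rfl⟩
  have := (hC.2.2.2 x hx).map hemb.continuous.continuousAt hemb.injective
  rwa [Filter.map_principal] at this

theorem isBernsteinField_of_meets_cantorSets {K : Subfield ℝ} {c : ℝ} (hc : c ∉ K)
    (hK : ∀ C, IsCantorSet C → ∃ z ∈ C, z ∈ K) : IsBernsteinField K := by
  constructor
  · rintro ⟨C, hCK, hC⟩
    obtain ⟨_, ⟨x, hx, rfl⟩, hz⟩ := hK _ (hC.image_add_left c)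
    exact hc (by simpa using K.sub_mem hz (hCK hx))
  · rintro ⟨C, hCK, hC⟩
    obtain ⟨z, hz, hzK⟩ := hK C hC
    exact hCK hz hzK

theorem mk_isCantorSet_le : #{C : Set ℝ // IsCantorSet C} ≤ 𝔠 := by
  let b := TopologicalSpace.countableBasis ℝ
  have hb : TopologicalSpace.IsTopologicalBasis b := TopologicalSpace.isBasis_countableBasis ℝ
  have hinj : Function.Injective fun C : {C : Set ℝ // IsCantorSet C} =>
      {s : b | (s : Set ℝ) ⊆ (C : Set ℝ)ᶜ} := fun C D h => by
    have key : ∀ C : {C : Set ℝ // IsCantorSet C},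
        (C : Set ℝ)ᶜ = ⋃ s ∈ {s : b | (s : Set ℝ) ⊆ (C : Set ℝ)ᶜ}, (s : Set ℝ) := fun C => by
      ext x
      simp only [mem_iUnion]
      constructor
      · intro hx
        obtain ⟨s, hs, hxs, hsC⟩ :=
          hb.exists_subset_of_mem_open hx C.2.2.1.isClosed.isOpen_compl
        exact ⟨⟨s, hs⟩, hsC, hxs⟩
      · rintro ⟨s, hs, hxs⟩
        exact hs hxs
    apply Subtype.ext
    rw [← compl_inj_iff, key C, key D]
    exact congrArg (fun S : Set b => ⋃ s ∈ S, (s : Set ℝ)) h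
  refine (mk_le_of_injective hinj).trans ?_
  rw [mk_set, ← two_power_aleph0]
  exact power_le_power_left two_ne_zero
    (le_aleph0_iff_set_countable.2 (TopologicalSpace.countable_countableBasis ℝ))

theorem exists_transcendenceBasis_cantorSet :
    ∃ D T : Set ℝ, IsCantorSet D ∧ IsTranscendenceBasis ℚ ((↑) : T → ℝ) ∧ D ⊆ T ∧
      #(T \ D : Set ℝ) = 𝔠 := by
  obtain ⟨f, hf⟩ := exists_algebraicIndependent_continuousMap
  have hcomp : IsCompact (range f) := isCompact_range f.continuous
  have hunc : ¬ (range f).Countable := fun h => by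
    have h1 := le_aleph0_iff_set_countable.2 h
    rw [mk_range_eq f hf.injective] at h1
    exact absurd h1 (not_le.2 (by simpa using aleph0_lt_continuum))
  obtain ⟨P, hP, hPne, hPf⟩ := exists_perfect_nonempty_of_isClosed_of_not_countable
    hcomp.isClosed hunc
  obtain ⟨D, D', ⟨hD, hDne, hDP⟩, ⟨hD', hDne', hDP'⟩, hdisj⟩ := hP.splitting hPne
  obtain ⟨T, hfT, hT⟩ := exists_isTranscendenceBasis_superset hf.to_subtype_range
  have hDT : D ⊆ T := hDP.trans (hPf.trans hfT)
  refine ⟨D, T, isCantorSet_of_perfect hD hDne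
    (hcomp.of_isClosed_subset hD.closed (hDP.trans hPf)) fun x hx => ?_, hT, hDT, ?_⟩
  · exact hT.1.transcendental ⟨x, hDT hx⟩
  · refine le_antisymm ((mk_set_le _).trans_eq mk_real) ?_
    rw [← hD'.mk_real_eq hDne']
    exact mk_le_mk_of_subset fun x hx =>
      ⟨hfT (hPf (hDP' hx)), fun h => disjoint_left.1 hdisj h hx⟩

theorem exists_transcendenceBasis_meets_cantorSets :
    ∃ T₀ T : Set ℝ, (∀ C, IsCantorSet C → ∃ z ∈ C, z ∈ T₀) ∧
      IsTranscendenceBasis ℚ ((↑) : T → ℝ) ∧ T₀ ⊆ T ∧ #(T \ T₀ : Set ℝ) = 𝔠 := by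
  obtain ⟨x, hx, hind⟩ := exists_algebraicIndependent_mem
    (Sum.elim (fun C : {C : Set ℝ // IsCantorSet C} => (C : Set ℝ)) fun _ : ℝ => univ)
    (by
      rw [mk_sum, lift_id, lift_id, mk_real]
      calc _ ≤ 𝔠 + 𝔠 := by gcongr; exact mk_isCantorSet_le
        _ = 𝔠 := continuum_add_self)
    (by
      rintro (C | r)
      · exact C.2.mk_eq
      · exact mk_univ_real)
  obtain ⟨T, hxT, hT⟩ := exists_isTranscendenceBasis_superset hind.to_subtype_range
  refine ⟨range (x ∘ Sum.inl), T, fun C hC => ⟨x (.inl ⟨C, hC⟩), hx (.inl ⟨C, hC⟩), ⟨_, rfl⟩⟩, hT,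
    (range_comp_subset_range _ _).trans hxT, ?_⟩
  refine le_antisymm ((mk_set_le _).trans_eq mk_real) ?_
  have hinj : Function.Injective (x ∘ Sum.inr) := hind.injective.comp Sum.inr_injective
  rw [← mk_real, ← mk_range_eq _ hinj]
  refine mk_le_mk_of_subset ?_
  rintro _ ⟨r, rfl⟩
  refine ⟨hxT ⟨_, rfl⟩, ?_⟩
  rintro ⟨C, hC⟩
  exact Sum.inl_ne_inr (hind.injective hC)

theorem mk_range_of_le_imp_eq {S : Set ℝ} (hS : #S = 𝔠) {K : Set S → Subfield ℝ}
    (hK : ∀ A B, K A ≤ K B → A = B) : #(range K) = 2 ^ 𝔠 := by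
  rw [mk_range_eq K fun A B h => hK A B h.le, mk_set, hS]

/-- Theorem 1: four families of subfields of ℝ, each of size 2^𝔠, over each of
which ℝ is algebraic, consisting of Cantor fields (𝒞₁, 𝒞₂) resp. Bernstein
fields (ℬ₁, ℬ₂), all fields in 𝒞₁ ∪ ℬ₁ isomorphic, fields in 𝒞₂ ∪ ℬ₂
incomparable. -/
theorem exists_cantor_bernstein_field_families :
    ∃ C1 C2 B1 B2 : Set (Subfield ℝ),
      Cardinal.mk C1 = 2 ^ Cardinal.continuum ∧
      Cardinal.mk C2 = 2 ^ Cardinal.continuum ∧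
      Cardinal.mk B1 = 2 ^ Cardinal.continuum ∧
      Cardinal.mk B2 = 2 ^ Cardinal.continuum ∧
      (∀ K ∈ C1 ∪ C2 ∪ B1 ∪ B2, Algebra.IsAlgebraic K ℝ) ∧
      (∀ K ∈ C1 ∪ C2, IsCantorField K) ∧
      (∀ K ∈ B1 ∪ B2, IsBernsteinField K) ∧
      (∀ K ∈ C1 ∪ B1, ∀ L ∈ C1 ∪ B1, Nonempty (K ≃+* L)) ∧
      (∀ K ∈ C2 ∪ B2, ∀ L ∈ C2 ∪ B2, K ≠ L → IsEmpty (K →+* L)) := by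
  obtain ⟨D, T, hD, hT, hDT, hcard⟩ := exists_transcendenceBasis_cantorSet
  obtain ⟨T₀, T', hT₀, hT', hsub, hcard'⟩ := exists_transcendenceBasis_meets_cantorSets
  obtain ⟨F, E, hF, hE, hFinj, hEinj⟩ := exists_subfield_families hT hDT hcard
  obtain ⟨F', E', hF', hE', hFinj', hEinj'⟩ := exists_subfield_families hT' hsub hcard'
  have hCantor : ∀ K : Subfield ℝ, D ⊆ K → cbrtTwo ∉ K → IsCantorField K := fun K hK hc =>
    ⟨fun h => hc (h ▸ Subfield.mem_top _), D, hK, hD⟩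
  have hBernstein : ∀ K : Subfield ℝ, T₀ ⊆ K → cbrtTwo ∉ K → IsBernsteinField K := fun K hK hc =>
    isBernsteinField_of_meets_cantorSets hc fun C hC => by
      obtain ⟨z, hz, hzT⟩ := hT₀ C hC
      exact ⟨z, hz, hK hzT⟩
  refine ⟨range F, range E, range F', range E', mk_range_of_le_imp_eq hcard hFinj,
    mk_range_of_le_imp_eq hcard hEinj, mk_range_of_le_imp_eq hcard' hFinj',
    mk_range_of_le_imp_eq hcard' hEinj', ?_, ?_, ?_, ?_, ?_⟩
  · rintro _ (((⟨A, rfl⟩ | ⟨A, rfl⟩) | ⟨A, rfl⟩) | ⟨A, rfl⟩)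
    · exact (hF A).2.2.1
    · exact (hE A).2.2.1
    · exact (hF' A).2.2.1
    · exact (hE' A).2.2.1
  · rintro _ (⟨A, rfl⟩ | ⟨A, rfl⟩)
    · exact hCantor _ (hF A).1 (hF A).2.1
    · exact hCantor _ (hE A).1 (hE A).2.1
  · rintro _ (⟨A, rfl⟩ | ⟨A, rfl⟩)
    · exact hBernstein _ (hF' A).1 (hF' A).2.1
    · exact hBernstein _ (hE' A).1 (hE' A).2.1
  · have hiso : ∀ K ∈ range F ∪ range F',
        Nonempty (K ≃+* FractionRing (MvPolynomial ℝ ℚ)) := by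
      rintro _ (⟨A, rfl⟩ | ⟨A, rfl⟩)
      · exact (hF A).2.2.2
      · exact (hF' A).2.2.2
    intro K hK L hL
    obtain ⟨e⟩ := hiso K hK
    obtain ⟨e'⟩ := hiso L hL
    exact ⟨e.trans e'.symm⟩
  · have hsqrt : ∀ K ∈ range E ∪ range E', ∀ x ∈ K, 0 ≤ x → √x ∈ K := by
      rintro _ (⟨A, rfl⟩ | ⟨A, rfl⟩)
      · exact (hE A).2.2.2
      · exact (hE' A).2.2.2
    intro K hK L hL hne
    by_contra hhom
    obtain ⟨φ⟩ := not_isEmpty_iff.1 hhom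
    have hle := le_of_ringHom_of_sqrt_mem (hsqrt K hK) φ
    rcases hK with ⟨A, rfl⟩ | ⟨A, rfl⟩ <;> rcases hL with ⟨B, rfl⟩ | ⟨B, rfl⟩
    · exact hne (congrArg E (hEinj A B hle))
    · exact (hBernstein _ (hE' B).1 (hE' B).2.1).1 ⟨D, (hE A).1.trans hle, hD⟩
    · exact (hBernstein _ ((hE' A).1.trans hle) (hE B).2.1).1 ⟨D, (hE B).1, hD⟩
    · exact hne (congrArg E' (hEinj' A B hle))
end
end

section
/- If K is a proper subfield of ℝ which contains a Cantor set, then ℝ \ K contains a Cantor set as well. -/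
noncomputable section

open Set Cardinal

theorem IsCantorSet.image_homeomorph {C : Set ℝ} (hC : IsCantorSet C) (e : ℝ ≃ₜ ℝ) :
    IsCantorSet (e '' C) := by
  obtain ⟨hne, hcomp, htd, hperf⟩ := hC
  refine ⟨hne.image e, hcomp.image e.continuous,
    e.isEmbedding.isTotallyDisconnected_image.mpr htd, ?_⟩
  rintro _ ⟨c, hc, rfl⟩
  simpa using (hperf c hc).map e.continuous.continuousAt e.injective

/-- If K is a proper subfield of ℝ which contains a Cantor set, then ℝ \ K
contains a Cantor set as well. -/
theorem cantor_set_in_complement (K : Subfield ℝ) (hK : K ≠ ⊤)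
    (h : ∃ C ⊆ (K : Set ℝ), IsCantorSet C) :
    ∃ C ⊆ (K : Set ℝ)ᶜ, IsCantorSet C := by
  obtain ⟨C, hCK, hC⟩ := h
  obtain ⟨x, -, hx⟩ := SetLike.exists_of_lt hK.lt_top
  refine ⟨_, ?_, hC.image_homeomorph (Homeomorph.addRight x)⟩
  rintro _ ⟨c, hc, rfl⟩ hmem
  exact hx ((add_mem_cancel_left (hCK hc)).mp hmem)
end
end

section
/- Let θ ∈ ℝ be irrational and let K be a subfield of ℝ such that θ ∉ K, but θ ∈ L for every subfield L of ℝ with K ⊆ L and L ≠ K. Then the dimension of ℝ as a vector space over K equals ℵ₀. -/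
noncomputable section

open Set Cardinal

section MaximalSubfields

open Polynomial IntermediateField Module

variable {K L : Type*} [Field K] [Field L] [Algebra K L]

theorem notMem_adjoin_sq_of_transcendental {x : L} (hx : Transcendental K x) :
    x ∉ K⟮x ^ 2⟯ := by
  intro h
  obtain ⟨r, s, hrs⟩ := (mem_adjoin_simple_iff K x).1 h
  have hs : aeval (x ^ 2) s ≠ 0 := by
    intro h0
    rw [h0, div_zero] at hrs
    exact hx (hrs ▸ isAlgebraic_zero)
  have hs0 : s ≠ 0 := by
    rintro rfl
    simp at hs
  rw [eq_div_iff hs] at hrs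
  have key : X * expand K 2 s = expand K 2 r := by
    apply transcendental_iff_injective.1 hx
    simpa [expand_aeval] using hrs
  have hdeg := congrArg natDegree key
  rw [natDegree_X_mul ((expand_ne_zero two_pos).2 hs0), natDegree_expand, natDegree_expand] at hdeg
  omega

theorem mem_bot_of_isAlgebraic_of_mem_adjoin_transcendental {x t : L} (ht : Transcendental K t)
    (hx : IsAlgebraic K x) (hxt : x ∈ K⟮t⟯) : x ∈ (⊥ : IntermediateField K L) := by
  let e := RatFunc.algEquivOfTranscendental t ht
  have hx' : IsAlgebraic K (⟨x, hxt⟩ : K⟮t⟯) :=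
    (isAlgebraic_algebraMap_iff (algebraMap K⟮t⟯ L).injective).1 hx
  have halg : IsAlgebraic K (e.symm ⟨x, hxt⟩) := hx'.algHom e.symm.toAlgHom
  obtain ⟨c, hc⟩ : ∃ c, e.symm ⟨x, hxt⟩ = RatFunc.C c := by
    by_contra hcon
    exact RatFunc.transcendental_of_ne_C _ hcon halg
  rw [AlgEquiv.symm_apply_eq, ← RatFunc.algebraMap_eq_C, e.commutes] at hc
  exact mem_bot.2 ⟨c, (congrArg Subtype.val hc).symm⟩

theorem isAlgebraic_of_mem_of_ne_bot {x : L} (hx : x ∉ (⊥ : IntermediateField K L))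
    (hmax : ∀ E : IntermediateField K L, E ≠ ⊥ → x ∈ E) : Algebra.IsAlgebraic K L := by
  have hmem : ∀ t : L, Transcendental K t → x ∈ K⟮t⟯ := fun t ht => by
    refine hmax _ fun hbot => ?_
    obtain ⟨c, rfl⟩ := mem_bot.1 (adjoin_simple_eq_bot_iff.1 hbot)
    exact ht (isAlgebraic_algebraMap c)
  have hxalg : IsAlgebraic K x := by
    by_contra h
    exact notMem_adjoin_sq_of_transcendental h (hmem _ fun h2 => h (IsAlgebraic.of_pow two_pos h2))
  refine ⟨fun t => ?_⟩
  by_contra ht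
  exact hx (mem_bot_of_isAlgebraic_of_mem_adjoin_transcendental ht hxalg (hmem t ht))

theorem exists_isPrimitiveRoot_of_finrank_eq_prime [CharZero K] [IsAlgClosed L]
    [FiniteDimensional K L] {p : ℕ} (hp : p.Prime) (hfin : finrank K L = p) :
    ∃ ζ : K, IsPrimitiveRoot ζ p := by
  have : CharZero L := charZero_of_injective_algebraMap (algebraMap K L).injective
  have : NeZero (p : L) := ⟨Nat.cast_ne_zero.2 hp.ne_zero⟩
  obtain ⟨ζ, hζ⟩ := IsAlgClosed.exists_root (cyclotomic p L)
    (degree_cyclotomic_pos p L hp.pos).ne'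
  have hroot : aeval ζ (cyclotomic p K) = 0 := by
    rwa [aeval_def, eval₂_eq_eval_map, map_cyclotomic]
  have hlt : (minpoly K ζ).natDegree < p := by
    have := natDegree_le_of_dvd (minpoly.dvd K ζ hroot) (cyclotomic_ne_zero p K)
    rw [natDegree_cyclotomic, Nat.totient_prime hp] at this
    have := hp.pos
    omega
  have hdvd : (minpoly K ζ).natDegree ∣ p :=
    hfin ▸ minpoly.degree_dvd (Algebra.IsIntegral.isIntegral ζ)
  have hone : (minpoly K ζ).natDegree = 1 := (hp.eq_one_or_self_of_dvd _ hdvd).resolve_right hlt.ne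
  obtain ⟨z, hz⟩ := minpoly.natDegree_eq_one_iff.1 hone
  refine ⟨z, IsPrimitiveRoot.of_map_of_injective (f := algebraMap K L) ?_
    (algebraMap K L).injective⟩
  rw [hz]
  exact isRoot_cyclotomic_iff.1 hζ

theorem isGalois_of_isAlgClosed (K L : Type*) [Field K] [Field L] [Algebra K L] [CharZero K]
    [IsAlgClosed L] [Algebra.IsAlgebraic K L] : IsGalois K L :=
  have : IsAlgClosure K L := ⟨inferInstance, inferInstance⟩
  have := IsAlgClosure.normal K L
  IsGalois.mk

theorem not_prime_finrank_of_isAlgClosed [CharZero K] [IsAlgClosed L] [FiniteDimensional K L]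
    [IsGalois K L] [IsCyclic Gal(L/K)] (hi : IsSquare (-1 : K)) : ¬ (finrank K L).Prime := by
  intro hp
  set p := finrank K L with hpdef
  obtain ⟨ζ, hζ⟩ := exists_isPrimitiveRoot_of_finrank_eq_prime (L := L) hp rfl
  have hne : (primitiveRoots p K).Nonempty := ⟨ζ, (mem_primitiveRoots hp.pos).2 hζ⟩
  obtain ⟨β, ⟨b, hb⟩, hβ⟩ := exists_root_adjoin_eq_top_of_isCyclic K L hne
  rw [← hpdef] at hb
  have hirr : Irreducible (X ^ p - C b) := irreducible_X_pow_sub_C_of_root_adjoin_eq_top hb.symm hβ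
  have hmin : minpoly K β = X ^ p - C b :=
    (minpoly.eq_of_irreducible_of_monic hirr (by simp [hb]) (monic_X_pow_sub_C b hp.ne_zero)).symm
  obtain ⟨γ, hγ⟩ := IsAlgClosed.exists_pow_nat_eq β hp.pos
  have hint : IsIntegral K β := Algebra.IsIntegral.isIntegral β
  have hnorm : Algebra.norm K β = (-1) ^ p * -b := by
    have h1 : finrank K⟮β⟯ L = 1 := by rw [hβ]; exact IntermediateField.finrank_top
    have h2 := Algebra.PowerBasis.norm_gen_eq_coeff_zero_minpoly (adjoin.powerBasis hint)
    rw [Algebra.norm_eq_norm_adjoin, h1, pow_one]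
    rw [adjoin.powerBasis_gen, minpoly_gen, hmin, adjoin.powerBasis_dim, hmin] at h2
    rw [h2, natDegree_X_pow_sub_C]
    simp [hp.ne_zero.symm]
  have hpow : ∃ c : K, c ^ p = b := by
    have hN : Algebra.norm K γ ^ p = (-1) ^ p * -b := by rw [← map_pow, hγ, hnorm]
    rcases hp.eq_two_or_odd' with h2 | hodd
    · obtain ⟨i, hi⟩ := hi
      refine ⟨i * Algebra.norm K γ, ?_⟩
      rw [mul_pow, hN, h2, sq i, ← hi]
      ring
    · exact ⟨Algebra.norm K γ, by rw [hN, hodd.neg_one_pow]; ring⟩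
  obtain ⟨c, hc⟩ := hpow
  exact X_pow_sub_C_irreducible_iff_of_prime hp |>.1 hirr c hc

theorem finrank_eq_one_of_isAlgClosed [CharZero K] [IsAlgClosed L] [FiniteDimensional K L]
    (hi : IsSquare (-1 : K)) : finrank K L = 1 := by
  have := isGalois_of_isAlgClosed K L
  by_contra hne
  obtain ⟨p, hp, hdvd⟩ := Nat.exists_prime_and_dvd hne
  have := Fact.mk hp
  rw [← IsGalois.card_aut_eq_finrank] at hdvd
  obtain ⟨σ, hσ⟩ := exists_prime_orderOf_dvd_card' p hdvd
  let M := fixedField (Subgroup.zpowers σ)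
  have hM : finrank M L = p := by
    rw [finrank_fixedField_eq_card, Nat.card_zpowers, hσ]
  have : IsCyclic Gal(L/M) :=
    isCyclic_of_prime_card (p := p) (by rw [IsGalois.card_aut_eq_finrank, hM])
  refine not_prime_finrank_of_isAlgClosed (K := M) (L := L) ?_ (hM ▸ hp)
  simpa using hi.map (algebraMap K M)

section Countable

variable {f g : L →ₐ[K] L}

/-- Two tuples on which `f` and `g` act by the same index maps generate the same field
over the common fixed field of `f` and `g`. -/
theorem exists_aeval_eq_of_same_action
    (hfix : ∀ z, f z = z → g z = z → z ∈ Set.range (algebraMap K L))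
    {n : ℕ} {σ τ : Fin n → Fin n} {x y : Fin n → L} (hx : Function.Injective x)
    (hfx : ∀ i, f (x i) = x (σ i)) (hgx : ∀ i, g (x i) = x (τ i))
    (hfy : ∀ i, f (y i) = y (σ i)) (hgy : ∀ i, g (y i) = y (τ i)) :
    ∃ q : K[X], ∀ i, aeval (x i) q = y i := by
  let P := Lagrange.interpolate Finset.univ x y
  have hdeg : P.degree < (Finset.univ : Finset (Fin n)).card :=
    Lagrange.degree_interpolate_lt _ hx.injOn
  have heval : ∀ i, P.eval (x i) = y i := fun i =>
    Lagrange.eval_interpolate_at_node _ hx.injOn (Finset.mem_univ i)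
  have hinv : ∀ (h : L →ₐ[K] L) (ρ : Fin n → Fin n), (∀ i, h (x i) = x (ρ i)) →
      (∀ i, h (y i) = y (ρ i)) → P.map (h : L →+* L) = P := by
    intro h ρ hhx hhy
    have hρ : Function.Surjective ρ := Finite.surjective_of_injective fun i j hij =>
      hx (h.injective (((hhx i).trans (by rw [hij])).trans (hhx j).symm))
    refine Polynomial.eq_of_degrees_lt_of_eval_index_eq _ hx.injOn
      ((degree_map_le).trans_lt hdeg) hdeg fun j _ => ?_
    obtain ⟨i, rfl⟩ := hρ j
    have := eval_map_apply (h : L →+* L) (p := P) (x i)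
    simp only [RingHom.coe_coe, hhx, heval, hhy] at this
    rw [this, heval]
  have hf := hinv f σ hfx hfy
  have hg := hinv g τ hgx hgy
  have hlift : P ∈ lifts (algebraMap K L) := by
    rw [lifts_iff_coeff_lifts]
    intro k
    apply hfix
    · simpa using congrArg (coeff · k) hf
    · simpa using congrArg (coeff · k) hg
  obtain ⟨q, hq⟩ := (mem_lifts P).1 hlift
  exact ⟨q, fun i => by rw [aeval_def, eval₂_eq_eval_map, hq, heval]⟩

theorem exists_tuple_of_isAlgebraic [Algebra.IsAlgebraic K L] (f g : L →ₐ[K] L) (z : L) :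
    ∃ (n : ℕ) (σ τ : Fin n → Fin n) (x : Fin n → L), Function.Injective x ∧
      (∀ i, f (x i) = x (σ i)) ∧ (∀ i, g (x i) = x (τ i)) ∧ ∃ i, x i = z := by
  have hne : minpoly K z ≠ 0 := minpoly.ne_zero (Algebra.IsIntegral.isIntegral z)
  let S := (minpoly K z).rootSet L
  have : Fintype S := rootSetFintype _ _
  let e := (Fintype.equivFin S).symm
  have hact : ∀ (h : L →ₐ[K] L) (s : S), h s ∈ S := fun h s => by
    rw [mem_rootSet_of_ne hne, aeval_algHom_apply, (mem_rootSet_of_ne hne).1 s.2, map_zero]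
  refine ⟨Fintype.card S, fun i => e.symm ⟨f (e i), hact f _⟩, fun i => e.symm ⟨g (e i), hact g _⟩,
    fun i => e i, Subtype.val_injective.comp e.injective, by simp, by simp, ?_⟩
  exact ⟨e.symm ⟨z, (mem_rootSet_of_ne hne).2 (minpoly.aeval K z)⟩, by simp⟩

theorem rank_le_aleph0_of_fixed_by_two [Algebra.IsAlgebraic K L]
    (hfix : ∀ z, f z = z → g z = z → z ∈ Set.range (algebraMap K L)) :
    Module.rank K L ≤ Cardinal.aleph0 := by
  classical
  let IsTuple (n : ℕ) (σ τ : Fin n → Fin n) (x : Fin n → L) : Prop :=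
    Function.Injective x ∧ (∀ i, f (x i) = x (σ i)) ∧ ∀ i, g (x i) = x (τ i)
  let rep (n : ℕ) (σ τ : Fin n → Fin n) : Fin n → L :=
    if h : ∃ x, IsTuple n σ τ x then h.choose else 0
  let B : (Σ n : ℕ, (Fin n → Fin n) × (Fin n → Fin n) × Fin n × ℕ) → L :=
    fun a => rep a.1 a.2.1 a.2.2.1 a.2.2.2.1 ^ a.2.2.2.2
  have hspan : Submodule.span K (Set.range B) = ⊤ := by
    refine eq_top_iff.2 fun z _ => ?_
    obtain ⟨n, σ, τ, y, hy, hfy, hgy, i, rfl⟩ := exists_tuple_of_isAlgebraic f g z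
    have hex : ∃ x, IsTuple n σ τ x := ⟨y, hy, hfy, hgy⟩
    have hrep : IsTuple n σ τ (rep n σ τ) := by
      simp only [rep, dif_pos hex]
      exact hex.choose_spec
    obtain ⟨q, hq⟩ := exists_aeval_eq_of_same_action hfix hrep.1 hrep.2.1 hrep.2.2 hfy hgy
    rw [← hq i, aeval_eq_sum_range]
    exact Submodule.sum_mem _ fun k _ =>
      Submodule.smul_mem _ _ (Submodule.subset_span ⟨⟨n, σ, τ, i, k⟩, rfl⟩)
  rw [← rank_top, ← hspan]
  exact (rank_span_le _).trans (Set.countable_range B).le_aleph0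

end Countable

theorem mem_fixedField_zpowers_iff (g : Gal(L/K)) {z : L} :
    z ∈ fixedField (Subgroup.zpowers g) ↔ g z = z := by
  rw [mem_fixedField_iff]
  refine ⟨fun h => h g (Subgroup.mem_zpowers g), fun h => ?_⟩
  exact (Subgroup.zpowers_le (H := MulAction.stabilizer Gal(L/K) z)).2 h

theorem rank_real_le_aleph0 {K : Subfield ℝ} {x : ℝ} (hx : x ∉ (⊥ : IntermediateField K ℝ))
    (hmax : ∀ E : IntermediateField K ℝ, E ≠ ⊥ → x ∈ E) : Module.rank K ℝ ≤ Cardinal.aleph0 := by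
  have := isAlgebraic_of_mem_of_ne_bot hx hmax
  have : Algebra.IsAlgebraic K ℂ := Algebra.IsAlgebraic.trans K ℝ ℂ
  have := isGalois_of_isAlgClosed K ℂ
  obtain ⟨g, hg⟩ : ∃ g : Gal(ℂ/K), g (x : ℂ) ≠ x := by
    by_contra! h
    obtain ⟨c, hc⟩ := (InfiniteGalois.mem_range_algebraMap_iff_fixed (x : ℂ)).2 h
    exact hx (mem_bot.2 ⟨c, Complex.ofReal_injective hc⟩)
  let ι : ℝ →ₐ[K] ℂ := IsScalarTower.toAlgHom K ℝ ℂ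
  let E : IntermediateField K ℝ := (fixedField (Subgroup.zpowers g)).comap ι
  have hmem : ∀ r : ℝ, r ∈ E ↔ g r = r := fun r => mem_fixedField_zpowers_iff g
  have hE : E = ⊥ := by
    by_contra hne
    exact hg ((hmem x).1 (hmax E hne))
  have hfix : ∀ z : ℂ, (Complex.conjAe.toAlgHom.restrictScalars K) z = z → g.toAlgHom z = z →
      z ∈ Set.range (algebraMap K ℂ) := by
    intro z hz hgz
    obtain ⟨r, rfl⟩ := Complex.conj_eq_iff_real.1 hz
    obtain ⟨c, rfl⟩ := mem_bot.1 (hE ▸ (hmem r).2 hgz)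
    exact ⟨c, rfl⟩
  exact (LinearMap.rank_le_of_injective ι.toLinearMap ι.injective).trans
    (rank_le_aleph0_of_fixed_by_two hfix)

theorem finrank_real_eq_one (K : Subfield ℝ) [FiniteDimensional K ℝ] : finrank K ℝ = 1 := by
  have : FiniteDimensional K ℂ := FiniteDimensional.trans K ℝ ℂ
  have hone : finrank K⟮Complex.I⟯ ℂ = 1 := by
    refine finrank_eq_one_of_isAlgClosed ⟨AdjoinSimple.gen K Complex.I, ?_⟩
    ext
    simp
  have hle : finrank K K⟮Complex.I⟯ ≤ 2 := by
    rw [adjoin.finrank (Algebra.IsIntegral.isIntegral _)]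
    have hroot : aeval Complex.I (X ^ 2 + 1 : K[X]) = 0 := by simp
    have hdeg : (X ^ 2 + 1 : K[X]).natDegree = 2 := by compute_degree!
    exact hdeg ▸ natDegree_le_of_dvd (minpoly.dvd K _ hroot)
      (ne_zero_of_natDegree_gt (hdeg ▸ two_pos))
  have h1 := finrank_mul_finrank K K⟮Complex.I⟯ ℂ
  have h2 := finrank_mul_finrank K ℝ ℂ
  rw [Complex.finrank_real_complex] at h2
  rw [hone] at h1
  have : 0 < finrank K ℝ := finrank_pos
  omega

end MaximalSubfields

/-- If θ is irrational, θ ∉ K, but θ belongs to every subfield of ℝ strictly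
containing K, then [ℝ : K] = ℵ₀. -/
theorem rank_eq_aleph0_of_maximal_subfield (θ : ℝ) (hθ : Irrational θ)
    (K : Subfield ℝ) (hθK : θ ∉ K)
    (hmax : ∀ L : Subfield ℝ, K ≤ L → L ≠ K → θ ∈ L) :
    Module.rank K ℝ = Cardinal.aleph0 := by
  have hbot : θ ∉ (⊥ : IntermediateField K ℝ) := by
    rintro ⟨c, rfl⟩
    exact hθK c.2
  refine (rank_real_le_aleph0 hbot fun E hE => ?_).antisymm ?_
  · refine hmax E.toSubfield (fun k hk => E.algebraMap_mem ⟨k, hk⟩) fun hEK => hE ?_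
    refine eq_bot_iff.2 fun y hy => ?_
    have hyK : y ∈ K := hEK ▸ hy
    exact IntermediateField.mem_bot.2 ⟨⟨y, hyK⟩, rfl⟩
  · by_contra! hlt
    have : FiniteDimensional K ℝ := Module.rank_lt_aleph0_iff.1 hlt
    have htop := Subalgebra.bot_eq_top_of_finrank_eq_one (finrank_real_eq_one K)
    obtain ⟨c, hc⟩ := Algebra.mem_bot.1 (htop ▸ Algebra.mem_top : θ ∈ (⊥ : Subalgebra K ℝ))
    exact hbot (IntermediateField.mem_bot.2 ⟨c, hc⟩)
end
end

section
/- Every Cantor set C can be partitioned into 𝔠 Cantor sets; that is, there exists a family 𝒫 of pairwise disjoint Cantor sets with ⋃𝒫 = C and |𝒫| = 𝔠. -/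
noncomputable section

open Set Cardinal

theorem IsCantorSet.range_of_injective {X : Type*} [TopologicalSpace X] [CompactSpace X]
    [PerfectSpace X] [Nonempty X] {C : Set ℝ} (hC : IsCantorSet C) {g : X → ℝ}
    (hg : Continuous g) (hinj : Function.Injective g) (hsub : range g ⊆ C) :
    IsCantorSet (range g) := by
  refine ⟨range_nonempty g, isCompact_range hg, fun t ht => hC.2.2.1 t (ht.trans hsub), ?_⟩
  rintro _ ⟨x, rfl⟩
  have h : AccPt x (Filter.principal univ) := PerfectSpace.univ_preperfect x (mem_univ x)
  rw [accPt_iff_nhds] at h ⊢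
  intro U hU
  obtain ⟨y, hy, hne⟩ := h _ (hg.continuousAt hU)
  exact ⟨g y, ⟨hy.1, mem_range_self y⟩, hinj.ne hne⟩

theorem IsCantorSet.image_isClopen {C : Set ℝ} (hC : IsCantorSet C) {V : Set C}
    (hV : IsClopen V) (hne : V.Nonempty) : IsCantorSet (Subtype.val '' V) := by
  have : CompactSpace C := isCompact_iff_compactSpace.1 hC.2.1
  refine ⟨hne.image _, hV.isClosed.isCompact.image continuous_subtype_val,
    fun t ht => hC.2.2.1 t (ht.trans (Subtype.coe_image_subset C V)), ?_⟩
  obtain ⟨O, hO, rfl⟩ := isOpen_induced_iff.1 hV.isOpen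
  rw [Subtype.image_preimage_coe, inter_comm]
  exact hC.2.2.2.open_inter hO

theorem perfectSpace_nat_bool : PerfectSpace (ℕ → Bool) := by
  refine ⟨fun x _ => ?_⟩
  rw [accPt_iff_frequently]
  have h : Filter.Tendsto (fun n => Function.update x n (!x n)) Filter.atTop (nhds x) := by
    rw [tendsto_pi_nhds]
    intro i
    refine tendsto_const_nhds.congr' ?_
    filter_upwards [Filter.eventually_gt_atTop i] with n hn
    rw [Function.update_of_ne hn.ne]
  refine h.frequently (Filter.Frequently.of_forall fun n => ⟨fun he => ?_, mem_univ _⟩)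
  simpa using congrFun he n

/-- An open subset of a second countable, compact, Hausdorff, totally disconnected space is a
countable disjoint union of clopen sets. -/
theorem IsOpen.exists_disjoint_isClopen_iUnion_eq {X : Type*} [TopologicalSpace X]
    [CompactSpace X] [T2Space X] [TotallyDisconnectedSpace X] [SecondCountableTopology X]
    {s : Set X} (hs : IsOpen s) :
    ∃ W : ℕ → Set X, (∀ n, IsClopen (W n)) ∧ Pairwise (Function.onFun Disjoint W) ∧
      ⋃ n, W n = s := by
  have h : ∀ x, ∃ V : Set X, IsClopen V ∧ V ⊆ s ∧ (x ∈ s → x ∈ V) := by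
    intro x
    by_cases hx : x ∈ s
    · obtain ⟨V, hV, hxV, hVs⟩ := compact_exists_isClopen_in_isOpen hs hx
      exact ⟨V, hV, hVs, fun _ => hxV⟩
    · exact ⟨∅, isClopen_empty, empty_subset _, fun h => (hx h).elim⟩
  choose V hV hVs hxV using h
  obtain ⟨t, -, htc, hst⟩ := TopologicalSpace.countable_cover_nhdsWithin (f := V) (s := s)
    fun x hx => mem_nhdsWithin_of_mem_nhds ((hV x).isOpen.mem_nhds (hxV x hx))
  obtain ⟨U, hU⟩ := ((htc.image V).insert ∅).exists_eq_range (insert_nonempty _ _)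
  have hmem : ∀ n, U n = ∅ ∨ ∃ x ∈ t, V x = U n := fun n =>
    (hU ▸ mem_range_self n : U n ∈ insert ∅ (V '' t))
  have hUc : ∀ n, IsClopen (U n) := fun n => by
    obtain h | ⟨x, -, h⟩ := hmem n
    · exact h ▸ isClopen_empty
    · exact h ▸ hV x
  refine ⟨disjointed U, fun n => ?_, disjoint_disjointed U, ?_⟩
  · exact disjointedRec (fun _ _ h => h.diff (hUc _)) (hUc n)
  · rw [iUnion_disjointed]
    apply Subset.antisymm
    · refine iUnion_subset fun n => ?_
      obtain h | ⟨x, -, h⟩ := hmem n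
      · exact h ▸ empty_subset _
      · exact h ▸ hVs x
    · rw [← sUnion_range, ← hU]
      refine hst.trans (iUnion₂_subset fun x hx => ?_)
      exact subset_sUnion_of_mem (mem_insert_of_mem _ (mem_image_of_mem V hx))

/-- The product of two copies of the Cantor space is homeomorphic to the Cantor space. -/
def natBoolProdHomeomorph : (ℕ → Bool) × (ℕ → Bool) ≃ₜ (ℕ → Bool) :=
  (Homeomorph.sumArrowHomeomorphProdArrow (ι := ℕ) (ι' := ℕ) (X := Bool)).symm.trans
    (Homeomorph.piCongrLeft (Y := fun _ => Bool) Equiv.natSumNatEquivNat)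

/-- Every Cantor set can be partitioned into 𝔠 Cantor sets. -/
theorem cantorSet_partition (C : Set ℝ) (hC : IsCantorSet C) :
    ∃ P : Set (Set ℝ), (∀ D ∈ P, IsCantorSet D) ∧ P.PairwiseDisjoint id ∧
      ⋃₀ P = C ∧ Cardinal.mk P = Cardinal.continuum := by
  have : CompactSpace C := isCompact_iff_compactSpace.1 hC.2.1
  have : TotallyDisconnectedSpace C := totallyDisconnectedSpace_subtype_iff.2 hC.2.2.1
  have := perfectSpace_nat_bool
  obtain ⟨f, hfC, hfc, hfi⟩ := Perfect.exists_nat_bool_injection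
    (⟨hC.2.1.isClosed, hC.2.2.2⟩ : Perfect C) hC.1
  obtain ⟨W, hWc, hWd, hWU⟩ := IsOpen.exists_disjoint_isClopen_iUnion_eq
    (((isCompact_range hfc).isClosed.preimage
      (continuous_subtype_val (p := fun x => x ∈ C))).isOpen_compl)
  let g : (ℕ → Bool) → (ℕ → Bool) → ℝ := fun a z => f (natBoolProdHomeomorph (a, z))
  have hg : ∀ {a b x y}, g a x = g b y → a = b ∧ x = y := fun h =>
    Prod.mk.inj (natBoolProdHomeomorph.injective (hfi h))
  have hgC : ∀ a, range (g a) ⊆ C := fun a =>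
    range_subset_iff.2 fun z => hfC (mem_range_self _)
  let F : (ℕ → Bool) ⊕ {n // (W n).Nonempty} → Set ℝ :=
    Sum.elim (fun a => range (g a)) (fun n => Subtype.val '' W n)
  have hF : ∀ i, IsCantorSet (F i) := by
    rintro (a | ⟨n, hn⟩)
    · exact hC.range_of_injective (by dsimp only [g]; fun_prop) (fun x y h => (hg h).2) (hgC a)
    · exact hC.image_isClopen (hWc n) hn
  have hrange : ∀ n, ∀ x ∈ W n, (x : ℝ) ∉ range f := fun n x hx =>
    (hWU ▸ mem_iUnion_of_mem n hx : x ∈ (Subtype.val ⁻¹' range f)ᶜ)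
  have hmix : ∀ a n, Disjoint (range (g a)) (Subtype.val '' W n) := by
    intro a n
    rw [Set.disjoint_left]
    rintro _ ⟨z, rfl⟩ ⟨x, hx, hxz⟩
    exact hrange n x hx ⟨_, hxz.symm⟩
  have hdisj : Pairwise (Function.onFun Disjoint F) := by
    rintro (a | n) (b | m) hne
    · refine Set.disjoint_left.2 ?_
      rintro _ ⟨x, rfl⟩ ⟨y, hy⟩
      exact hne (congrArg _ (hg hy).1.symm)
    · exact hmix a m
    · exact (hmix b n).symm
    · exact (disjoint_image_iff Subtype.val_injective).2
        (hWd fun h => hne (congrArg _ (Subtype.ext h)))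
  have hinj : Function.Injective F := by
    intro i j hij
    by_contra hne
    have h : Disjoint (F i) (F j) := hdisj hne
    rw [hij, disjoint_self] at h
    exact (hF j).1.ne_empty h
  refine ⟨range F, forall_mem_range.2 hF, ?_, ?_, ?_⟩
  · rintro _ ⟨i, rfl⟩ _ ⟨j, rfl⟩ hne
    exact hdisj fun h => hne (congrArg F h)
  · apply Subset.antisymm
    · refine sUnion_subset ?_
      rintro _ ⟨a | n, rfl⟩
      · exact hgC a
      · exact Subtype.coe_image_subset C _
    · intro x hx
      by_cases hxf : x ∈ range f
      · obtain ⟨z, rfl⟩ := hxf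
        refine ⟨_, ⟨Sum.inl (natBoolProdHomeomorph.symm z).1, rfl⟩,
          (natBoolProdHomeomorph.symm z).2, ?_⟩
        simp [g]
      · have : (⟨x, hx⟩ : C) ∈ ⋃ n, W n := by
          rw [hWU]
          exact hxf
        obtain ⟨n, hn⟩ := mem_iUnion.1 this
        exact ⟨_, ⟨Sum.inr ⟨n, _, hn⟩, rfl⟩, _, hn, rfl⟩
  · rw [Cardinal.mk_range_eq F hinj]
    simp only [mk_sum, lift_uzero, mk_pi, mk_bool, prod_const, mk_nat,
      two_power_aleph0]
    exact add_eq_left aleph0_le_continuum (mk_le_aleph0.trans aleph0_le_continuum)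
end
end
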